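/- Let X be a binary stream and let g : ℕ → ℕ be a computable function such that K(X↾n) ≤ g(n) for all n. Then there exists a Martin-Löf random binary stream Y such that X is computable from Y with oracle-use n ↦ min_{i≥n} g(i). -/

import Mathlib

open scoped ENNReal

abbrev BStr := List Bool

/-- The first `n` bits of the stream `X`, as a binary string. -/
def stake (X : ℕ → Bool) (n : ℕ) : BStr := (List.range n).map X

/-- A set of binary strings is prefix-free if no element is a proper prefix of another. -/
def PrefixFreeSet (S : Set BStr) : Prop :=
  ∀ σ ∈ S, ∀ τ ∈ S, σ <+: τ → σ = τ

/-- `X` is computable from `Y` with oracle-use `f`. -/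
def ComputableWithUse (X Y : ℕ → Bool) (f : ℕ → ℕ) : Prop :=
  ∃ F : ℕ × BStr →. BStr, Partrec F ∧ ∀ n, stake X n ∈ F (n, stake Y (f n))

/-- A prefix-free machine: partial computable with prefix-free domain. -/
def PrefixFreeMachine (M : BStr →. BStr) : Prop :=
  Partrec M ∧ PrefixFreeSet {ρ | (M ρ).Dom}

/-- `K_M σ`: least length of an `M`-description of `σ` (`⊤` if none). -/
noncomputable def KM (M : BStr →. BStr) (σ : BStr) : ℕ∞ :=
  sInf ((fun ρ : BStr => (ρ.length : ℕ∞)) '' {ρ | σ ∈ M ρ})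

/-- Universal prefix-free machine. -/
def UniversalPFM (U : BStr →. BStr) : Prop :=
  PrefixFreeMachine U ∧
    ∀ M : BStr →. BStr, PrefixFreeMachine M →
      ∃ c : ℕ, ∀ σ, KM U σ ≤ KM M σ + (c : ℕ∞)

/-- Prefix-free Kolmogorov complexity w.r.t. `U`, as a natural number. -/
noncomputable def Kof (U : BStr →. BStr) (σ : BStr) : ℕ := (KM U σ).toNat

/-- Martin-Löf randomness via Schnorr's characterization: `K(Y↾n) ≥ n - c`. -/
def MLRandom (U : BStr →. BStr) (Y : ℕ → Bool) : Prop :=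
  ∃ c : ℕ, ∀ n, n ≤ Kof U (stake Y n) + c

/-- The weight `2^{-I(σ)}` contributed by `σ` (zero if `I σ` is undefined). -/
noncomputable def iweight (I : BStr →. ℕ) (σ : BStr) : ℝ≥0∞ :=
  haveI := Classical.propDecidable (I σ).Dom
  if h : (I σ).Dom then ((2 : ℝ≥0∞) ^ ((I σ).get h))⁻¹ else 0

/-! ### Weights of sets of binary strings -/

/-- The weight `∑ 2^{-|σ|}` of a set of binary strings. -/
noncomputable def strWeight (C : Set BStr) : ℝ≥0∞ := ∑' c : C, (2⁻¹ : ℝ≥0∞) ^ (c : BStr).length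

theorem strWeight_mono {C D : Set BStr} (h : C ⊆ D) : strWeight C ≤ strWeight D :=
  ENNReal.tsum_mono_subtype (fun c : BStr => (2⁻¹ : ℝ≥0∞) ^ c.length) h

theorem one_le_strWeight_of_nil_mem {C : Set BStr} (h : [] ∈ C) : 1 ≤ strWeight C := by
  have := ENNReal.le_tsum (f := fun c : C => (2⁻¹ : ℝ≥0∞) ^ (c : BStr).length) ⟨[], h⟩
  simpa [strWeight] using this

/-- The tails of the elements of `C` starting with `b`. -/
def tails (b : Bool) (C : Set BStr) : Set BStr := {c | b :: c ∈ C}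

theorem strWeight_image_cons (b : Bool) (C : Set BStr) :
    strWeight (List.cons b '' C) = 2⁻¹ * strWeight C := by
  unfold strWeight
  rw [tsum_image (fun c : BStr => (2⁻¹ : ℝ≥0∞) ^ c.length) (List.cons_injective.injOn),
    ← ENNReal.tsum_mul_left]
  simp [pow_succ, mul_comm]

theorem eq_union_tails {C : Set BStr} (h : [] ∉ C) :
    C = List.cons false '' tails false C ∪ List.cons true '' tails true C := by
  ext c
  rcases c with _ | ⟨b, c⟩
  · simp [h]
  · cases b <;> simp [tails]

theorem strWeight_eq_tails {C : Set BStr} (h : [] ∉ C) :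
    strWeight C = 2⁻¹ * strWeight (tails false C) + 2⁻¹ * strWeight (tails true C) := by
  rw [← strWeight_image_cons, ← strWeight_image_cons]
  conv_lhs => rw [eq_union_tails h]
  unfold strWeight
  refine ENNReal.summable.tsum_union_disjoint (f := fun c : BStr => (2⁻¹ : ℝ≥0∞) ^ c.length)
    ?_ ENNReal.summable
  rw [Set.disjoint_left]
  rintro _ ⟨c, -, rfl⟩ ⟨d, -, hd⟩
  simp at hd

theorem half_mul_add_half_mul_one : (2⁻¹ : ℝ≥0∞) * 1 + 2⁻¹ * 1 = 1 := by
  simp [ENNReal.inv_two_add_inv_two]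

theorem one_le_strWeight_of_cover (B : ℕ) : ∀ C : Set BStr,
    (∀ z : BStr, z.length = B → ∃ c ∈ C, c <+: z) → 1 ≤ strWeight C := by
  induction B with
  | zero =>
    intro C h
    obtain ⟨c, hc, hp⟩ := h [] rfl
    obtain rfl := List.prefix_nil.1 hp
    exact one_le_strWeight_of_nil_mem hc
  | succ B ih =>
    intro C h
    by_cases hn : [] ∈ C
    · exact one_le_strWeight_of_nil_mem hn
    have key (b : Bool) : 1 ≤ strWeight (tails b C) := by
      refine ih _ fun z hz => ?_
      obtain ⟨c, hc, hp⟩ := h (b :: z) (by simp [hz])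
      rcases c with _ | ⟨a, c⟩
      · exact absurd hc hn
      obtain ⟨rfl, hp'⟩ := List.cons_prefix_cons.1 hp
      exact ⟨c, hc, hp'⟩
    rw [strWeight_eq_tails hn, ← half_mul_add_half_mul_one]
    gcongr <;> exact key _

theorem strWeight_le_one_of_length_le (B : ℕ) : ∀ C : Set BStr, PrefixFreeSet C →
    (∀ c ∈ C, c.length ≤ B) → strWeight C ≤ 1 := by
  have nil_case (C : Set BStr) (hC : PrefixFreeSet C) (hn : [] ∈ C) : strWeight C ≤ 1 := by
    have : C = {[]} := by
      ext c
      exact ⟨fun hc => (hC _ hn _ hc List.nil_prefix).symm,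
        fun hc => by rwa [Set.mem_singleton_iff.1 hc]⟩
    subst this
    simp [strWeight]
  induction B with
  | zero =>
    intro C hC h
    have h1 : C ⊆ {[]} := fun c hc => List.eq_nil_of_length_eq_zero (Nat.le_zero.1 (h c hc))
    refine (strWeight_mono h1).trans ?_
    simp [strWeight]
  | succ B ih =>
    intro C hC h
    by_cases hn : [] ∈ C
    · exact nil_case C hC hn
    have key (b : Bool) : strWeight (tails b C) ≤ 1 := by
      refine ih _ (fun σ hσ τ hτ hp => ?_) fun c hc => by simpa using h _ hc
      simpa using hC _ hσ _ hτ (List.cons_prefix_cons.2 ⟨rfl, hp⟩)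
    rw [strWeight_eq_tails hn, ← half_mul_add_half_mul_one]
    gcongr <;> exact key _

/-- Kraft's inequality. -/
theorem strWeight_le_one_of_prefixFree {C : Set BStr} (hC : PrefixFreeSet C) :
    strWeight C ≤ 1 := by
  unfold strWeight
  rw [ENNReal.tsum_eq_iSup_sum]
  refine iSup_le fun s => ?_
  set D : Set BStr := Subtype.val '' (s : Set C) with hD
  have hDC : D ⊆ C := by rintro _ ⟨c, -, rfl⟩; exact c.2
  have : strWeight D ≤ 1 := by
    refine strWeight_le_one_of_length_le (s.sup fun c => (c : BStr).length) D
      (fun σ hσ τ hτ => hC σ (hDC hσ) τ (hDC hτ)) ?_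
    rintro _ ⟨c, hc, rfl⟩
    exact Finset.le_sup (f := fun c : C => (c : BStr).length) hc
  refine le_trans (le_of_eq ?_) this
  unfold strWeight
  rw [hD, tsum_image (fun c : BStr => (2⁻¹ : ℝ≥0∞) ^ c.length) Subtype.val_injective.injOn]
  exact (Finset.tsum_subtype' s (fun c : C => (2⁻¹ : ℝ≥0∞) ^ (c : BStr).length)).symm

/-! ### Initial segments of streams -/

theorem take_stake (p : ℕ → Bool) {i n : ℕ} (h : i ≤ n) : (stake p n).take i = stake p i := by
  simp [stake, ← List.map_take, List.take_range, h]

theorem stake_length (X : ℕ → Bool) (n : ℕ) : (stake X n).length = n := by simp [stake]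

theorem stake_injective (X : ℕ → Bool) : Function.Injective (stake X) := fun m n h => by
  simpa [stake_length] using congrArg List.length h

/-- König's lemma for sets of binary strings closed under taking prefixes. -/
theorem exists_stream_of_prefix_closed {A : BStr → Prop} (hA : ∀ y b, A (y ++ [b]) → A y)
    (hinf : ∀ n, ∃ y, A y ∧ y.length = n) : ∃ Y : ℕ → Bool, ∀ n, A (stake Y n) := by
  have hpre : ∀ z y : BStr, A (y ++ z) → A y := by
    intro z
    induction z using List.reverseRecOn with
    | nil => simp
    | append_singleton z b ih =>
      intro y h
      exact ih y (hA _ b (by simpa using h))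
  let E (y : BStr) : Prop := ∀ n, ∃ z, z.length = n ∧ A (y ++ z)
  have hstep (y : BStr) (hy : E y) : ∃ b, E (y ++ [b]) := by
    by_contra! hno
    simp only [E] at hno
    push Not at hno
    choose f hf using hno
    obtain ⟨z, hz, hAz⟩ := hy (max (f false) (f true) + 1)
    rcases z with _ | ⟨b, z⟩
    · simp at hz
    · have hle : f b ≤ z.length := by
        simp only [List.length_cons, Nat.add_right_cancel_iff] at hz
        cases b <;> omega
      refine hf b (z.take (f b)) (by simp [hle]) (hpre (z.drop (f b)) _ ?_)
      simpa using hAz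
  have h0 : E [] := fun n => by
    obtain ⟨y, hy, hn⟩ := hinf n
    exact ⟨y, hn, hy⟩
  choose f hf using hstep
  let g : ℕ → {y // E y} := fun n =>
    Nat.rec ⟨[], h0⟩ (fun _ y => ⟨y.1 ++ [f y.1 y.2], hf y.1 y.2⟩) n
  refine ⟨fun n => f (g n).1 (g n).2, fun n => ?_⟩
  have hg : ∀ n, stake (fun n => f (g n).1 (g n).2) n = (g n).1 := by
    intro n
    induction n with
    | zero => rfl
    | succ n ih =>
      have : stake (fun n => f (g n).1 (g n).2) (n + 1) =
          stake (fun n => f (g n).1 (g n).2) n ++ [f (g n).1 (g n).2] := by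
        simp [stake, List.range_succ]
      rw [this, ih]
  obtain ⟨z, hz, h⟩ := (hg n ▸ (g n).2 : E (stake (fun n => f (g n).1 (g n).2) n)) 0
  simpa [List.eq_nil_of_length_eq_zero hz] using h

/-! ### The labelling game

Strings `y` are labelled by sequences `v` with `|y| = |v| + 1`, in such a way that the label of a
one-bit extension of `y` is a one-term extension of the label of `y`. Strings with a prefix in a
list of forbidden strings are dead; a sequence is served if it labels a string that is not dead. -/

namespace LabelGame

variable {α : Type}

/-- The labelled strings with their labels, and the forbidden strings. -/
abbrev State (α : Type) := List (BStr × List α) × List BStr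

/-- `y` has a forbidden prefix. -/
abbrev Dead (qs : List BStr) (y : BStr) : Prop := ∃ q ∈ qs, y.take q.length = q

/-- Some string labelled `w` is not dead. -/
abbrev Served (S : State α) (w : List α) : Prop := ∃ p ∈ S.1, p.2 = w ∧ ¬ Dead S.2 p.1

/-- The string `y` is labelled. -/
abbrev Labelled (L : List (BStr × List α)) (y : BStr) : Prop := ∃ p ∈ L, p.1 = y

/-- The initial state: both strings of length one are labelled by the empty sequence. -/
def init : State α := ([([false], []), ([true], [])], [])

/-- `y` is dead or both its one-bit extensions are labelled. -/
def Exhausted (S : State α) (y : BStr) : Prop := Dead S.2 y ∨ ∀ b, Labelled S.1 (y ++ [b])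

theorem Exhausted.mono {S S' : State α} (h1 : ∀ p ∈ S.1, p ∈ S'.1) (h2 : ∀ q ∈ S.2, q ∈ S'.2)
    {y : BStr} (h : Exhausted S y) : Exhausted S' y := by
  rcases h with ⟨q, hq, h⟩ | h
  · exact Or.inl ⟨q, h2 q hq, h⟩
  · refine Or.inr fun b => ?_
    obtain ⟨p, hp, h⟩ := h b
    exact ⟨p, h1 p hp, h⟩

/-- The invariants of the labelling. -/
structure Inv (T : Set (List α)) (S : State α) : Prop where
  root : ∀ b, ([b], []) ∈ S.1
  len : ∀ {y v}, (y, v) ∈ S.1 → y.length = v.length + 1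
  mem : ∀ {y v}, (y, v) ∈ S.1 → v ≠ [] → v ∈ T
  func : ∀ {y v v'}, (y, v) ∈ S.1 → (y, v') ∈ S.1 → v = v'
  dropLast : ∀ {y v}, (y, v) ∈ S.1 → v ≠ [] → (y.dropLast, v.dropLast) ∈ S.1
  unique : ∀ {y y' v}, (y, v) ∈ S.1 → (y', v) ∈ S.1 → v ≠ [] →
    ¬ Exhausted S y → ¬ Exhausted S y' → y = y'

theorem inv_init (T : Set (List α)) : Inv T init where
  root b := by cases b <;> simp [init]
  len h := by simp [init] at h; grind
  mem h := by simp [init] at h; grind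
  func h h' := by simp [init] at h h'; grind
  dropLast h := by simp [init] at h; grind
  unique h := by simp [init] at h; grind

theorem Inv.forbid {T : Set (List α)} {S : State α} (h : Inv T S) (qs : List BStr) :
    Inv T (S.1, qs ++ S.2) where
  root := h.root
  len := h.len
  mem := h.mem
  func := h.func
  dropLast := h.dropLast
  unique h1 h2 h3 h4 h5 := by
    have key {y : BStr} (hy : Exhausted S y) : Exhausted (S.1, qs ++ S.2) y :=
      Exhausted.mono (S := S) (S' := (S.1, qs ++ S.2)) (fun _ => id)
        (fun _ => List.mem_append_right _) hy
    exact h.unique h1 h2 h3 (mt key h4) (mt key h5)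

theorem primrec_dead : PrimrecRel (Dead : List BStr → BStr → Prop) := by
  have : PrimrecRel fun (q y : BStr) => y.take q.length = q :=
    Primrec.eq.comp (Primrec.list_take.comp (Primrec.list_length.comp Primrec.fst) Primrec.snd)
      Primrec.fst
  exact this.exists_mem_list

theorem primrec_served [Primcodable α] : PrimrecRel (Served : State α → List α → Prop) := by
  have : PrimrecRel fun (p : BStr × List α) (x : List BStr × List α) =>
      p.2 = x.2 ∧ ¬ Dead x.1 p.1 := by
    refine PrimrecPred.and ?_ (PrimrecPred.not ?_)
    · exact Primrec.eq.comp (Primrec.snd.comp Primrec.fst) (Primrec.snd.comp Primrec.snd)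
    · exact primrec_dead.comp (Primrec.fst.comp Primrec.snd) (Primrec.fst.comp Primrec.fst)
  exact this.exists_mem_list.comp (Primrec.fst.comp Primrec.fst)
    (Primrec.pair (Primrec.snd.comp Primrec.fst) Primrec.snd)

theorem primrec_labelled [Primcodable α] :
    PrimrecRel (Labelled : List (BStr × List α) → BStr → Prop) := by
  have : PrimrecRel fun (p : BStr × List α) (y : BStr) => p.1 = y :=
    Primrec.eq.comp (Primrec.fst.comp Primrec.fst) Primrec.snd
  exact this.exists_mem_list

variable [DecidableEq α]

/-- Labelled strings whose label is a proper prefix of `w`. -/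
def below (L : List (BStr × List α)) (w : List α) : List (BStr × List α) :=
  L.filter fun p => p.2.length < w.length ∧ w.take p.2.length = p.2

/-- Unlabelled one-bit extensions of strings labelled by proper prefixes of `w`. -/
def candidates (L : List (BStr × List α)) (w : List α) : List BStr :=
  ((below L w).flatMap fun p => [p.1 ++ [false], p.1 ++ [true]]).filter fun z => ¬ Labelled L z

/-- A longest element of a list of strings. -/
def longest (l : List BStr) : BStr :=
  l.foldl (fun a z => if a.length < z.length then z else a) []

/-- Attend to the request `w`: if it is not served, label a longest candidate. -/
def attend (S : State α) (w : List α) : List (BStr × List α) :=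
  if Served S w ∨ longest (candidates S.1 w) = [] then S.1
  else (longest (candidates S.1 w), w.take ((longest (candidates S.1 w)).length - 1)) :: S.1

/-- One stage of the game. -/
def step (S : State α) (e : Option (List α) × Option BStr) : State α :=
  ((e.1.map (attend S)).getD S.1, e.2.toList ++ S.2)

/-- The state of the game after `s` stages. -/
def state (e : ℕ → Option (List α) × Option BStr) (s : ℕ) : State α :=
  Nat.rec init (fun s S => step S (e s)) s

theorem mem_candidates {L : List (BStr × List α)} {w : List α} {z : BStr} :
    z ∈ candidates L w ↔ (∃ y v b, (y, v) ∈ L ∧ v.length < w.length ∧ w.take v.length = v ∧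
      z = y ++ [b]) ∧ ¬ Labelled L z := by
  simp only [candidates, below, List.mem_filter, List.mem_flatMap, decide_eq_true_eq,
    List.mem_cons, List.not_mem_nil, or_false]
  refine and_congr_left fun _ => ⟨?_, ?_⟩
  · rintro ⟨⟨y, v⟩, ⟨h, h1, h2⟩, h3 | h3⟩
    exacts [⟨y, v, _, h, h1, h2, h3⟩, ⟨y, v, _, h, h1, h2, h3⟩]
  · rintro ⟨y, v, b, h, h1, h2, h3⟩
    refine ⟨(y, v), ⟨h, h1, h2⟩, ?_⟩
    cases b
    exacts [Or.inl h3, Or.inr h3]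

theorem foldl_longest (l : List BStr) (a : BStr) :
    (l.foldl (fun a z => if a.length < z.length then z else a) a ∈ a :: l) ∧
    ∀ z ∈ a :: l, z.length ≤
      (l.foldl (fun a z => if a.length < z.length then z else a) a).length := by
  induction l generalizing a with
  | nil => simp
  | cons x l ih =>
    obtain ⟨h1, h2⟩ := ih (if a.length < x.length then x else a)
    simp only [List.foldl_cons]
    constructor
    · split_ifs at h1 ⊢ <;> simp only [List.mem_cons] at h1 ⊢ <;> tauto
    · intro z hz
      have h3 := h2 _ List.mem_cons_self
      simp only [List.mem_cons] at hz
      rcases hz with rfl | rfl | hz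
      · refine le_trans ?_ h3
        split_ifs <;> omega
      · refine le_trans ?_ h3
        split_ifs <;> omega
      · exact h2 z (List.mem_cons_of_mem _ hz)

theorem longest_mem {l : List BStr} (h : longest l ≠ []) : longest l ∈ l :=
  (List.mem_cons.1 (foldl_longest l []).1).resolve_left h

theorem length_le_longest {l : List BStr} {z : BStr} (h : z ∈ l) :
    z.length ≤ (longest l).length :=
  (foldl_longest l []).2 z (List.mem_cons_of_mem _ h)

/-- What attending to an unserved request does when there is a candidate. -/
theorem exists_attend_eq {T : Set (List α)} {S : State α} (h : Inv T S) {w : List α}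
    (hs : ¬ Served S w) (hc : longest (candidates S.1 w) ≠ []) :
    ∃ y v b, (y, v) ∈ S.1 ∧ v.length < w.length ∧ w.take v.length = v ∧
      ¬ Labelled S.1 (y ++ [b]) ∧
      (∀ z ∈ candidates S.1 w, z.length ≤ v.length + 2) ∧
      attend S w = (y ++ [b], w.take (v.length + 1)) :: S.1 := by
  obtain ⟨⟨y, v, b, h1, h2, h3, h4⟩, h5⟩ := mem_candidates.1 (longest_mem hc)
  have hl := h.len h1
  refine ⟨y, v, b, h1, h2, h3, h4 ▸ h5, fun z hz => ?_, ?_⟩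
  · have := length_le_longest hz
    rw [h4] at this
    simpa [hl] using this
  · rw [attend, if_neg (not_or.2 ⟨hs, hc⟩), h4]
    simp [hl]

theorem subset_attend (S : State α) (w : List α) : ∀ p ∈ S.1, p ∈ attend S w := by
  intro p hp
  unfold attend
  split_ifs
  · exact hp
  · exact List.mem_cons_of_mem _ hp

theorem Inv.attend {T : Set (List α)} {S : State α} (h : Inv T S) {w : List α}
    (hw : ∀ i, w.take i ∈ T) : Inv T (attend S w, S.2) := by
  by_cases hs : Served S w ∨ longest (candidates S.1 w) = []
  · rw [LabelGame.attend, if_pos hs]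
    exact h
  rw [not_or] at hs
  obtain ⟨y, v, b, h1, h2, h3, h4, h5, h6⟩ := exists_attend_eq h hs.1 hs.2
  have hmono {x : BStr} (hx : Exhausted S x) : Exhausted (LabelGame.attend S w, S.2) x :=
    hx.mono (S' := (LabelGame.attend S w, S.2)) (subset_attend S w) fun _ => id
  have hlen : (w.take (v.length + 1)).length = v.length + 1 := by simp; omega
  have hne : w.take (v.length + 1) ≠ [] := by
    intro h0
    simp [h0] at hlen
  have hfull {x : BStr} (hx : (x, w.take (v.length + 1)) ∈ S.1) : Exhausted S x := by
    by_contra hex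
    unfold Exhausted at hex
    push Not at hex
    obtain ⟨hd, c, hc⟩ := hex
    rcases Nat.lt_or_ge (v.length + 1) w.length with hlt | hge
    · have hxl := h.len hx
      have : x ++ [c] ∈ candidates S.1 w := by
        refine mem_candidates.2 ⟨⟨x, _, c, hx, by omega, by rw [hlen], rfl⟩, ?_⟩
        rintro ⟨p, hp, hpx⟩
        exact hc p hp hpx
      have := h5 _ this
      simp at this
      omega
    · rw [List.take_of_length_le hge] at hx
      exact hs.1 ⟨(x, w), hx, rfl, by simpa [Dead] using hd⟩
  rw [h6] at hmono ⊢
  refine ⟨fun b => List.mem_cons_of_mem _ (h.root b), ?_, ?_, ?_, ?_, ?_⟩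
  · intro x u hx
    rcases List.mem_cons.1 hx with hx | hx
    · obtain ⟨rfl, rfl⟩ := Prod.mk.inj hx
      rw [hlen, List.length_append, h.len h1]
      rfl
    · exact h.len hx
  · intro x u hx hu
    rcases List.mem_cons.1 hx with hx | hx
    · obtain ⟨rfl, rfl⟩ := Prod.mk.inj hx
      exact hw _
    · exact h.mem hx hu
  · intro x u u' hx hx'
    rcases List.mem_cons.1 hx with hx | hx <;> rcases List.mem_cons.1 hx' with hx' | hx'
    · rw [(Prod.mk.inj hx).2, (Prod.mk.inj hx').2]
    · rw [(Prod.mk.inj hx).1] at hx'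
      exact absurd ⟨_, hx', rfl⟩ h4
    · rw [(Prod.mk.inj hx').1] at hx
      exact absurd ⟨_, hx, rfl⟩ h4
    · exact h.func hx hx'
  · intro x u hx hu
    rcases List.mem_cons.1 hx with hx | hx
    · obtain ⟨rfl, rfl⟩ := Prod.mk.inj hx
      refine List.mem_cons_of_mem _ ?_
      have : (w.take (v.length + 1)).dropLast = v := by
        rw [List.dropLast_eq_take, hlen, List.take_take]
        simpa using h3
      rw [this]
      simpa using h1
    · exact List.mem_cons_of_mem _ (h.dropLast hx hu)
  · intro x x' u hx hx' hu he he'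
    rcases List.mem_cons.1 hx with hx | hx <;> rcases List.mem_cons.1 hx' with hx' | hx'
    · rw [(Prod.mk.inj hx).1, (Prod.mk.inj hx').1]
    · rw [(Prod.mk.inj hx).2] at hx'
      exact absurd (hmono (hfull hx')) he'
    · rw [(Prod.mk.inj hx').2] at hx
      exact absurd (hmono (hfull hx)) he
    · exact h.unique hx hx' hu (mt hmono he) (mt hmono he')

theorem Inv.step {T : Set (List α)} {S : State α} (h : Inv T S)
    {e : Option (List α) × Option BStr} (he : ∀ w, e.1 = some w → ∀ i, w.take i ∈ T) :
    Inv T (step S e) := by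
  obtain ⟨_ | w, q⟩ := e
  · exact h.forbid _
  · exact (h.attend (he w rfl)).forbid _

/-- The weight of a set of labels: a label `v` is carried by strings of length `|v| + 1`. -/
noncomputable def labelWeight (T : Set (List α)) : ℝ≥0∞ :=
  ∑' v : {v : List α | v ∈ T ∧ v ≠ []}, (2⁻¹ : ℝ≥0∞) ^ ((v : List α).length + 1)

/-- If the total weight is less than one, an unserved request has a candidate. -/
theorem longest_candidates_ne_nil {T : Set (List α)} {Q : Set BStr} {S : State α} (h : Inv T S)
    (hQ : ∀ q ∈ S.2, q ∈ Q) (hW : labelWeight T + strWeight Q < 1) {w : List α}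
    (hs : ¬ Served S w) : longest (candidates S.1 w) ≠ [] := by
  intro hc
  have hno : ∀ z, z ∉ candidates S.1 w := by
    intro z hz
    have h1 := length_le_longest hz
    obtain ⟨⟨y, v, b, -, -, -, rfl⟩, -⟩ := mem_candidates.1 hz
    simp [hc] at h1
  set N : Set BStr := {y | (∃ v, (y, v) ∈ S.1 ∧ v ≠ []) ∧ ¬ Exhausted S y} with hN
  have hNW : strWeight N ≤ labelWeight T := by
    choose f hf using fun y : N => y.2.1
    have hinj : Function.Injective
        (fun y : N => (⟨f y, h.mem (hf y).1 (hf y).2, (hf y).2⟩ : {v | v ∈ T ∧ v ≠ []})) := by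
      intro y y' hy
      have hy : f y = f y' := congrArg Subtype.val hy
      have h1 := (hf y').1
      rw [← hy] at h1
      exact Subtype.ext (h.unique (hf y).1 h1 (hf y).2 y.2.2 y'.2.2)
    refine le_trans (le_of_eq ?_) (ENNReal.tsum_comp_le_tsum_of_injective hinj _)
    unfold strWeight
    refine tsum_congr fun y => ?_
    rw [h.len (hf y).1]
  set B := (S.1.map fun p => p.1.length).sum + 1 with hB
  have hlab : ∀ y, Labelled S.1 y → y.length < B := by
    rintro y ⟨p, hp, rfl⟩
    have := List.single_le_sum (l := S.1.map fun p => p.1.length) (by simp) _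
      (List.mem_map_of_mem hp)
    omega
  have hcov : 1 ≤ strWeight (N ∪ Q) := by
    refine one_le_strWeight_of_cover B _ fun z hz => ?_
    classical
    set n := Nat.findGreatest (fun n => Labelled S.1 (z.take n)) B with hn
    have h1 : Labelled S.1 (z.take 1) := by
      rcases z with _ | ⟨b, z⟩
      · simp [hB] at hz
      · exact ⟨_, h.root b, by simp⟩
    have hlabn : Labelled S.1 (z.take n) :=
      Nat.findGreatest_spec (P := fun n => Labelled S.1 (z.take n)) (by omega) h1
    have hnB : n < B := by
      have h2 := hlab _ hlabn
      rw [List.length_take, hz] at h2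
      omega
    have hnext : ¬ Labelled S.1 (z.take (n + 1)) :=
      Nat.findGreatest_is_greatest (P := fun n => Labelled S.1 (z.take n)) (Nat.lt_succ_self n)
        hnB
    have hzn : z.take (n + 1) = z.take n ++ [z[n]'(by omega)] := by
      rw [List.take_append_getElem]
    by_cases hd : Dead S.2 (z.take n)
    · obtain ⟨q, hq, hqz⟩ := hd
      refine ⟨q, Or.inr (hQ q hq), ?_⟩
      rw [← hqz]
      exact (List.take_prefix _ _).trans (List.take_prefix _ _)
    · refine ⟨z.take n, Or.inl ?_, List.take_prefix _ _⟩
      obtain ⟨⟨_, v⟩, hp, rfl⟩ := hlabn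
      refine ⟨⟨v, hp, ?_⟩, ?_⟩
      · rintro rfl
        rcases eq_or_ne w [] with rfl | hw
        · exact hs ⟨_, hp, rfl, hd⟩
        · refine hno (z.take (n + 1)) (mem_candidates.2 ⟨⟨_, [], _, hp, ?_, rfl, hzn⟩, hnext⟩)
          simpa [List.length_pos_iff] using hw
      · rintro (h2 | h2)
        · exact hd h2
        · exact hnext (hzn ▸ h2 _)
  have : strWeight (N ∪ Q) ≤ strWeight N + strWeight Q := 
    ENNReal.tsum_union_le (fun c : BStr => (2⁻¹ : ℝ≥0∞) ^ c.length) N Q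
  exact absurd (hcov.trans (this.trans (add_le_add_left hNW _))) (not_le.2 hW)

variable {e : ℕ → Option (List α) × Option BStr}

theorem state_subset_succ (e : ℕ → Option (List α) × Option BStr) (s : ℕ) :
    (∀ p ∈ (state e s).1, p ∈ (state e (s + 1)).1) ∧
    ∀ q ∈ (state e s).2, q ∈ (state e (s + 1)).2 := by
  change _ ∧ ∀ q ∈ (state e s).2, q ∈ (step (state e s) (e s)).2
  refine ⟨?_, fun q hq => List.mem_append_right _ hq⟩
  change ∀ p ∈ (state e s).1, p ∈ (step (state e s) (e s)).1
  intro p hp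
  unfold step
  rcases (e s).1 with _ | w
  · exact hp
  · exact subset_attend _ _ _ hp

theorem labels_mono {s t : ℕ} (h : s ≤ t) {p} (hp : p ∈ (state e s).1) : p ∈ (state e t).1 := by
  induction h with
  | refl => exact hp
  | step _ ih => exact (state_subset_succ e _).1 _ ih

theorem forbidden_mono {s t : ℕ} (h : s ≤ t) {q} (hq : q ∈ (state e s).2) :
    q ∈ (state e t).2 := by
  induction h with
  | refl => exact hq
  | step _ ih => exact (state_subset_succ e _).2 _ ih

theorem Dead.state_mono {s t : ℕ} (h : s ≤ t) {y} (hy : Dead (state e s).2 y) :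
    Dead (state e t).2 y := by
  obtain ⟨q, hq, hy⟩ := hy
  exact ⟨q, forbidden_mono h hq, hy⟩

theorem mem_forbidden_of_eq_some {s : ℕ} {q : BStr} (h : (e s).2 = some q) :
    q ∈ (state e (s + 1)).2 := by
  change q ∈ (step (state e s) (e s)).2
  simp [step, h]

section Limit

variable {T : Set (List α)} {Q : Set BStr} (hT : ∀ s w, (e s).1 = some w → ∀ i, w.take i ∈ T)
  (hQ : ∀ s q, (e s).2 = some q → q ∈ Q)

include hT in
theorem inv_state (s : ℕ) : Inv T (state e s) := by
  induction s with
  | zero => exact inv_init T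
  | succ s ih => exact ih.step (hT s)

include hQ in
theorem forbidden_subset (s : ℕ) : ∀ q ∈ (state e s).2, q ∈ Q := by
  induction s with
  | zero => intro q hq; simp [state, init] at hq
  | succ s ih =>
    intro q hq
    rcases List.mem_append.1 (show q ∈ (e s).2.toList ++ (state e s).2 from hq) with h | h
    · exact hQ s q (by simpa using h)
    · exact ih q h

/-- `y` eventually receives the label `v` and never dies. -/
def Good (e : ℕ → Option (List α) × Option BStr) (y : BStr) (v : List α) : Prop :=
  (∃ s, (y, v) ∈ (state e s).1) ∧ ∀ s, ¬ Dead (state e s).2 y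

include hT hQ in
theorem exists_good (hW : labelWeight T + strWeight Q < 1) {w : List α}
    (hw : ∀ s₀, ∃ s ≥ s₀, (e s).1 = some w) : ∃ y, Good e y w := by
  by_contra! hno
  have hev (P : ℕ → BStr → Prop) (hP : ∀ y s t, s ≤ t → P s y → P t y) :
      ∃ s, ∀ y : BStr, y.length ≤ w.length + 1 → (∃ t, P t y) → P s y := by
    have hfin : {y : BStr | y.length ≤ w.length + 1}.Finite := List.finite_length_le _ _
    have : ∀ y, ∃ s, (∃ t, P t y) → P s y := by
      intro y
      by_cases h : ∃ t, P t y
      · obtain ⟨t, ht⟩ := h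
        exact ⟨t, fun _ => ht⟩
      · exact ⟨0, fun h' => absurd h' h⟩
    choose f hf using this
    refine ⟨hfin.toFinset.sup f, fun y hy h => hP y _ _ ?_ (hf y h)⟩
    exact Finset.le_sup (f := f) (by simpa using hy)
  obtain ⟨s₁, h₁⟩ := hev (fun s y => Dead (state e s).2 y) fun y s t h => Dead.state_mono h
  obtain ⟨s₂, h₂⟩ := hev (fun s y => Labelled (state e s).1 y) fun y s t h hp => by
    obtain ⟨p, hp, hy⟩ := hp
    exact ⟨p, labels_mono h hp, hy⟩
  obtain ⟨s, hs, hes⟩ := hw (max s₁ s₂)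
  have hinv := inv_state hT s
  have hsv : ¬ Served (state e s) w := by
    rintro ⟨⟨y, _⟩, hy, rfl, hd⟩
    refine hno y ⟨⟨s, hy⟩, fun t ht => hd ?_⟩
    exact Dead.state_mono (le_trans (le_max_left _ _) hs)
      (h₁ y (hinv.len hy).le ⟨t, ht⟩)
  obtain ⟨y, v, b, hy, hv, -, hl, -, hat⟩ := exists_attend_eq hinv hsv
    (longest_candidates_ne_nil hinv (forbidden_subset hQ s) hW hsv)
  have hnew : Labelled (state e (s + 1)).1 (y ++ [b]) := by
    refine ⟨(y ++ [b], w.take (v.length + 1)), ?_, rfl⟩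
    change _ ∈ (step (state e s) (e s)).1
    rw [step, hes, Option.map_some, Option.getD_some, hat]
    exact List.mem_cons_self
  refine hl ?_
  obtain ⟨p, hp, hpy⟩ := h₂ (y ++ [b]) (by simp [hinv.len hy]; omega) ⟨_, hnew⟩
  exact ⟨p, labels_mono (le_trans (le_max_right _ _) hs) hp, hpy⟩

include hT hQ in
/-- Every path of infinitely often requested sequences is the sequence of labels along some
stream without forbidden prefixes. -/
theorem exists_stream (hW : labelWeight T + strWeight Q < 1) (p : ℕ → α)
    (hp : ∀ m s₀, ∃ s ≥ s₀, (e s).1 = some ((List.range m).map p)) :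
    ∃ Y : ℕ → Bool, (∀ m, ∃ s, (stake Y (m + 1), (List.range m).map p) ∈ (state e s).1) ∧
      ∀ s q n, (e s).2 = some q → stake Y n ≠ q := by
  have hdead {y : BStr} {b : Bool} {s : ℕ} (h : Dead (state e s).2 y) :
      Dead (state e s).2 (y ++ [b]) := by
    obtain ⟨q, hq, hy⟩ := h
    refine ⟨q, hq, ?_⟩
    have hle : q.length ≤ y.length := by
      conv_lhs => rw [← hy]
      exact List.length_take_le' _ _
    rw [List.take_append_of_le_length hle, hy]
  let A (y : BStr) : Prop := y = [] ∨ Good e y ((List.range (y.length - 1)).map p)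
  obtain ⟨Y, hY⟩ : ∃ Y : ℕ → Bool, ∀ n, A (stake Y n) := by
    refine exists_stream_of_prefix_closed ?_ ?_
    · rintro y b (h | ⟨⟨s, hs⟩, hd⟩)
      · simp at h
      refine or_iff_not_imp_left.2 fun hy => ⟨⟨s, ?_⟩, fun t ht => hd t (hdead ht)⟩
      obtain ⟨k, hk⟩ : ∃ k, y.length = k + 1 := by
        have := List.length_pos_iff.2 hy
        exact ⟨y.length - 1, by omega⟩
      have hlen : (y ++ [b]).length - 1 = k + 1 := by simp [hk]
      rw [hlen] at hs
      have := (inv_state hT s).dropLast hs (by simp)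
      rw [hk]
      simpa [List.range_succ] using this
    · rintro (_ | n)
      · exact ⟨[], Or.inl rfl, rfl⟩
      · obtain ⟨y, hy⟩ := exists_good hT hQ hW (hp n)
        obtain ⟨s, hs⟩ := hy.1
        have hlen : y.length = n + 1 := by simpa using (inv_state hT s).len hs
        refine ⟨y, Or.inr ?_, hlen⟩
        rw [hlen]
        exact hy
  have hgood (m : ℕ) : Good e (stake Y (m + 1)) ((List.range m).map p) := by
    have := (hY (m + 1)).resolve_left (by simp [stake])
    simpa [stake] using this
  refine ⟨Y, fun m => (hgood m).1, fun s q n hq hn => (hgood n).2 (s + 1) ?_⟩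
  refine ⟨q, mem_forbidden_of_eq_some hq, ?_⟩
  have : q.length = n := by rw [← hn]; simp [stake]
  rw [this, take_stake _ (Nat.le_succ n), hn]

end Limit

theorem mem_of_lookup_eq_some {β γ : Type*} [DecidableEq β] {l : List (β × γ)} {y : β} {u : γ}
    (h : l.lookup y = some u) : (y, u) ∈ l := by
  obtain ⟨l₁, l₂, rfl, -⟩ := List.lookup_eq_some_iff.1 h
  simp

theorem exists_lookup_eq_some {β γ : Type*} [DecidableEq β] {l : List (β × γ)} {y : β} {u : γ}
    (h : (y, u) ∈ l) : ∃ v, l.lookup y = some v := by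
  rw [← Option.ne_none_iff_exists']
  intro hn
  rw [List.lookup_eq_none_iff] at hn
  simpa using hn _ h

/-- The label that is eventually given to a string. -/
def label (e : ℕ → Option (List α) × Option BStr) (y : BStr) : Part (List α) :=
  Nat.rfindOpt fun s => @List.lookup _ _ instBEqOfDecidableEq y (state e s).1

theorem mem_label {T : Set (List α)} (hT : ∀ s w, (e s).1 = some w → ∀ i, w.take i ∈ T)
    {y : BStr} {v : List α} {s : ℕ} (h : (y, v) ∈ (state e s).1) : v ∈ label e y := by
  obtain ⟨u, hu⟩ : ∃ u, u ∈ label e y := by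
    rw [← Part.dom_iff_mem, label, Nat.rfindOpt_dom]
    exact ⟨s, exists_lookup_eq_some h⟩
  obtain ⟨t, ht⟩ := Nat.rfindOpt_spec hu
  have h1 := labels_mono (le_max_left s t) h
  have h2 := labels_mono (le_max_right s t) (mem_of_lookup_eq_some ht)
  rwa [(inv_state hT _).func h1 h2]

section Computability

variable [Primcodable α]

theorem primrec_below : Primrec₂ (below : List (BStr × List α) → List α → _) := by
  have : PrimrecRel fun (p : BStr × List α) (w : List α) =>
      p.2.length < w.length ∧ w.take p.2.length = p.2 := by
    refine PrimrecPred.and ?_ ?_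
    · exact Primrec.nat_lt.comp (Primrec.list_length.comp (Primrec.snd.comp Primrec.fst))
        (Primrec.list_length.comp Primrec.snd)
    · exact Primrec.eq.comp (Primrec.list_take.comp
        (Primrec.list_length.comp (Primrec.snd.comp Primrec.fst)) Primrec.snd)
        (Primrec.snd.comp Primrec.fst)
  exact this.listFilter

theorem primrec_candidates : Primrec₂ (candidates : List (BStr × List α) → List α → _) := by
  have h : PrimrecRel fun (z : BStr) (L : List (BStr × List α)) => ¬ Labelled L z :=
    (primrec_labelled.comp Primrec.snd Primrec.fst).not
  refine h.listFilter.comp (Primrec.list_flatMap primrec_below ?_) Primrec.fst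
  have h1 (b : Bool) : Primrec fun x : (List (BStr × List α) × List α) × BStr × List α =>
      x.2.1 ++ [b] :=
    Primrec.list_append.comp (Primrec.fst.comp Primrec.snd) (Primrec.const _)
  exact Primrec.list_cons.comp (h1 false) (Primrec.list_cons.comp (h1 true) (Primrec.const _))

theorem primrec_longest : Primrec longest := by
  have h : Primrec fun x : List BStr × BStr × BStr =>
      if x.2.1.length < x.2.2.length then x.2.2 else x.2.1 := by
    refine Primrec.ite ?_ (Primrec.snd.comp Primrec.snd) (Primrec.fst.comp Primrec.snd)
    exact Primrec.nat_lt.comp (Primrec.list_length.comp (Primrec.fst.comp Primrec.snd))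
      (Primrec.list_length.comp (Primrec.snd.comp Primrec.snd))
  exact Primrec.list_foldl Primrec.id (Primrec.const []) h.to₂

theorem primrec_attend : Primrec₂ (attend : State α → List α → _) := by
  have hz : Primrec fun x : State α × List α => longest (candidates x.1.1 x.2) :=
    primrec_longest.comp (primrec_candidates.comp (Primrec.fst.comp Primrec.fst) Primrec.snd)
  refine Primrec.ite (PrimrecPred.or primrec_served ?_) (Primrec.fst.comp Primrec.fst) ?_
  · exact Primrec.eq.comp hz (Primrec.const _)
  · refine Primrec.list_cons.comp (Primrec.pair hz (Primrec.list_take.comp ?_ Primrec.snd))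
      (Primrec.fst.comp Primrec.fst)
    exact Primrec.nat_sub.comp (Primrec.list_length.comp hz) (Primrec.const _)

theorem primrec_step : Primrec₂ (step : State α → _ → _) := by
  refine Primrec.pair ?_ ?_
  · refine Primrec.option_getD.comp (Primrec.option_map (Primrec.fst.comp Primrec.snd) ?_)
      (Primrec.fst.comp Primrec.fst)
    exact primrec_attend.comp (Primrec.fst.comp Primrec.fst) Primrec.snd
  · refine Primrec.list_append.comp ?_ (Primrec.snd.comp Primrec.fst)
    have : Primrec (Option.toList : Option BStr → List BStr) :=
      (Primrec.option_casesOn Primrec.id (Primrec.const [])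
        (Primrec.list_cons.comp Primrec.snd (Primrec.const [])).to₂).of_eq
        fun o => by cases o <;> rfl
    exact this.comp (Primrec.snd.comp Primrec.snd)

theorem computable_state (he : Computable e) : Computable (state e) := by
  have h : Computable₂ fun (_ : ℕ) (x : ℕ × State α) => step x.2 (e x.1) :=
    primrec_step.to_comp.comp (Computable.snd.comp Computable.snd)
      (he.comp (Computable.fst.comp Computable.snd))
  refine (Computable.nat_rec Computable.id (Computable.const init) h).of_eq fun s => ?_
  induction s with
  | zero => rfl
  | succ s ih => exact congrArg (step · (e s)) ih

theorem partrec_label (he : Computable e) : Partrec (label e) := by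
  refine Partrec.rfindOpt ?_
  exact (Primrec.listLookup.to_comp.comp Computable.fst
    (Computable.fst.comp ((computable_state he).comp Computable.snd))).to₂

end Computability

end LabelGame

/-! ### Prefix-free complexity -/

section Complexity

variable {U : BStr →. BStr}

theorem prefixFreeMachine_nil (σ : BStr) :
    PrefixFreeMachine fun ρ => ((if ρ = [] then some σ else none : Option BStr) : Part BStr) := by
  constructor
  · refine Computable.ofOption (Primrec.to_comp ?_)
    exact Primrec.ite (Primrec.eq.comp Primrec.id (Primrec.const [])) (Primrec.const _)
      (Primrec.const _)
  · have key : ∀ ρ : BStr, ((if ρ = [] then some σ else none : Option BStr) : Part BStr).Dom →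
        ρ = [] := by
      intro ρ h
      by_contra hne
      simp [hne] at h
    intro ρ hρ τ hτ _
    rw [key ρ hρ, key τ hτ]

theorem UniversalPFM.KM_ne_top (hU : UniversalPFM U) (σ : BStr) : KM U σ ≠ ⊤ := by
  obtain ⟨c, hc⟩ := hU.2 _ (prefixFreeMachine_nil σ)
  refine ne_top_of_le_ne_top ?_ (hc σ)
  refine WithTop.add_ne_top.2 ⟨?_, ENat.natCast_ne_top c⟩
  refine ne_top_of_le_ne_top (ENat.natCast_ne_top 0) (sInf_le ⟨[], ?_, rfl⟩)
  simp

theorem UniversalPFM.exists_description (hU : UniversalPFM U) (σ : BStr) :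
    ∃ ρ, σ ∈ U ρ ∧ ρ.length = Kof U σ := by
  have hne : ((fun ρ : BStr => (ρ.length : ℕ∞)) '' {ρ | σ ∈ U ρ}).Nonempty := by
    by_contra h
    rw [Set.not_nonempty_iff_eq_empty] at h
    exact hU.KM_ne_top σ (by rw [KM, h, sInf_empty])
  obtain ⟨ρ, hρ, h⟩ := csInf_mem hne
  exact ⟨ρ, hρ, by rw [Kof, KM, ← h]; rfl⟩

theorem Kof_le_length {σ ρ : BStr} (h : σ ∈ U ρ) : Kof U σ ≤ ρ.length :=
  ENat.toNat_le_of_le_natCast (sInf_le ⟨ρ, h, rfl⟩)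

theorem UniversalPFM.tsum_Kof_le_one (hU : UniversalPFM U) :
    ∑' σ, (2⁻¹ : ℝ≥0∞) ^ Kof U σ ≤ 1 := by
  choose d hd hl using hU.exists_description
  let f : BStr → {ρ | (U ρ).Dom} := fun σ => ⟨d σ, Part.dom_iff_mem.2 ⟨σ, hd σ⟩⟩
  have hf : Function.Injective f := by
    intro σ τ h
    have h' : d σ = d τ := congrArg Subtype.val h
    exact Part.mem_unique (hd σ) (h' ▸ hd τ)
  calc ∑' σ, (2⁻¹ : ℝ≥0∞) ^ Kof U σ = ∑' σ, (2⁻¹ : ℝ≥0∞) ^ (f σ : BStr).length := by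
        simp only [f, hl]
    _ ≤ strWeight {ρ | (U ρ).Dom} := ENNReal.tsum_comp_le_tsum_of_injective hf
        fun ρ : {ρ | (U ρ).Dom} => (2⁻¹ : ℝ≥0∞) ^ (ρ : BStr).length
    _ ≤ 1 := strWeight_le_one_of_prefixFree hU.1.2

theorem UniversalPFM.strWeight_compressible_le (hU : UniversalPFM U) :
    strWeight {q | Kof U q + 2 < q.length} ≤ 2⁻¹ ^ 3 := by
  calc strWeight {q | Kof U q + 2 < q.length}
      ≤ ∑' q : {q : BStr | Kof U q + 2 < q.length}, (2⁻¹ : ℝ≥0∞) ^ (Kof U q + 3) := by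
        refine ENNReal.tsum_le_tsum fun q => ?_
        refine pow_le_pow_right_of_le_one' (by simp) ?_
        have := q.2
        simp only [Set.mem_ofPred_eq] at this
        omega
    _ ≤ ∑' q, (2⁻¹ : ℝ≥0∞) ^ (Kof U q + 3) :=
        ENNReal.tsum_comp_le_tsum_of_injective Subtype.val_injective
          fun q : BStr => (2⁻¹ : ℝ≥0∞) ^ (Kof U q + 3)
    _ = (∑' q, (2⁻¹ : ℝ≥0∞) ^ Kof U q) * 2⁻¹ ^ 3 := by
        rw [← ENNReal.tsum_mul_right]
        simp only [pow_add]
    _ ≤ 2⁻¹ ^ 3 := by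
        refine (mul_le_mul_left hU.tsum_Kof_le_one _).trans ?_
        rw [one_mul]

theorem UniversalPFM.finite_Kof_stake_le (hU : UniversalPFM U) (X : ℕ → Bool) (k : ℕ) :
    {n | Kof U (stake X n) ≤ k}.Finite := by
  have h := ENNReal.finite_const_le_of_tsum_ne_top
    (ne_top_of_le_ne_top ENNReal.one_ne_top hU.tsum_Kof_le_one)
    (pow_ne_zero k (by simp : (2⁻¹ : ℝ≥0∞) ≠ 0))
  refine (h.preimage (stake_injective X).injOn).subset fun n hn => ?_
  change (2⁻¹ : ℝ≥0∞) ^ k ≤ 2⁻¹ ^ Kof U (stake X n)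
  exact pow_le_pow_right_of_le_one' (by simp) hn

end Complexity

/-! ### Computability -/

/-- The graph of a partial computable function can be enumerated. -/
theorem Partrec.exists_enumeration {β γ : Type} [Primcodable β] [Primcodable γ] {f : β →. γ}
    (hf : Partrec f) :
    ∃ u : ℕ → Option (β × γ), Computable u ∧ ∀ b c, c ∈ f b ↔ ∃ s, u s = some (b, c) := by
  obtain ⟨c, hc⟩ := Nat.Partrec.Code.exists_code.1 hf
  have hspec (b : β) (m : ℕ) :
      m ∈ c.eval (Encodable.encode b) ↔ ∃ x ∈ f b, Encodable.encode x = m := by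
    rw [hc]
    simp
  refine ⟨fun s => (Encodable.decode (α := β) s.unpair.1).bind fun b =>
    (Nat.Partrec.Code.evaln s.unpair.2 c (Encodable.encode b)).bind fun m =>
      (Encodable.decode (α := γ) m).map fun x => (b, x), ?_, fun b x => ⟨fun h => ?_, ?_⟩⟩
  · have h : Primrec fun x : ℕ × β =>
        (Nat.Partrec.Code.evaln x.1.unpair.2 c (Encodable.encode x.2)).bind fun m =>
          (Encodable.decode (α := γ) m).map fun y => (x.2, y) := by
      refine Primrec.option_bind ?_ ?_
      · exact Nat.Partrec.Code.primrec_evaln.comp (Primrec.pair (Primrec.pair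
          (Primrec.snd.comp (Primrec.unpair.comp Primrec.fst)) (Primrec.const c))
          (Primrec.encode.comp Primrec.snd))
      · exact (Primrec.option_map (Primrec.decode.comp Primrec.snd)
          (Primrec.pair (Primrec.snd.comp (Primrec.fst.comp Primrec.fst)) Primrec.snd).to₂).to₂
    exact (Primrec.option_bind (Primrec.decode.comp (Primrec.fst.comp Primrec.unpair))
      h.to₂).to_comp
  · have := (hspec b _).2 ⟨x, h, rfl⟩
    obtain ⟨k, hk⟩ := Nat.Partrec.Code.evaln_complete.1 this
    refine ⟨Nat.pair (Encodable.encode b) k, ?_⟩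
    rw [Option.mem_def] at hk
    simp [hk]
  · rintro ⟨s, hs⟩
    simp only [Option.bind_eq_some_iff, Option.map_eq_some_iff, Prod.mk.injEq] at hs
    obtain ⟨b', -, m, hm, x', hx', rfl, rfl⟩ := hs
    obtain ⟨y, hy, rfl⟩ := (hspec b' m).1 (Nat.Partrec.Code.evaln_sound hm)
    rw [Encodable.encodek, Option.some_inj] at hx'
    exact hx' ▸ hy

theorem Computable.map_range {β γ : Type} [Primcodable β] [Primcodable γ] {f : β → ℕ → γ}
    (hf : Computable₂ f) : Computable₂ fun b n => (List.range n).map (f b) := by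
  have h : Computable₂ fun (x : β × ℕ) (y : ℕ × List γ) => y.2 ++ [f x.1 y.1] :=
    Primrec.list_append.to_comp.comp (Computable.snd.comp Computable.snd)
      (Primrec.list_cons.to_comp.comp (hf.comp (Computable.fst.comp Computable.fst)
        (Computable.fst.comp Computable.snd)) (Computable.const []))
  refine (Computable.nat_rec Computable.snd (Computable.const []) h).of_eq fun x => ?_
  obtain ⟨b, n⟩ := x
  induction n with
  | zero => rfl
  | succ n ih => simpa [List.range_succ] using ih

theorem Computable.filter_snd {β γ δ : Type} [Primcodable β] [Primcodable γ] [Primcodable δ]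
    {u : δ → Option (β × γ)} (hu : Computable u) {c : β × γ → Bool} (hc : Computable c) :
    Computable fun s => (u s).bind fun p => bif c p then some p.2 else none :=
  Computable.option_bind hu (Computable.cond (hc.comp Computable.snd)
    (Computable.option_some.comp (Computable.snd.comp Computable.snd)) (Computable.const none))

/-! ### Coding initial segments of a stream -/

section Coding

/-- The largest `n ≤ L` with `n₀ ≤ n` and `g n ≤ k`, or `0` if there is none. -/
def cut (g : ℕ → ℕ) (n₀ k L : ℕ) : ℕ := Nat.findGreatest (fun n => n₀ ≤ n ∧ g n ≤ k) L

/-- The sequence of length `m` whose `i`th term is the longest prefix `τ` of `σ` with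
`n₀ ≤ |τ|` and `g |τ| ≤ i + 2`, or the empty string if there is none. -/
def node (g : ℕ → ℕ) (n₀ : ℕ) (σ : BStr) (m : ℕ) : List BStr :=
  (List.range m).map fun i => σ.take (cut g n₀ (i + 2) σ.length)

/-- The sequences `node g n₀ σ m` where the prefixes of `σ` of length at least `n₀` are in `D`. -/
def nodes (g : ℕ → ℕ) (n₀ : ℕ) (D : Set BStr) : Set (List BStr) :=
  {v | ∃ σ m, node g n₀ σ m = v ∧ ∀ n ≤ σ.length, n₀ ≤ n → σ.take n ∈ D}

variable {g : ℕ → ℕ} {n₀ : ℕ}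

theorem cut_le (k L : ℕ) : cut g n₀ k L ≤ L := Nat.findGreatest_le _

theorem le_cut {k L n : ℕ} (hL : n ≤ L) (hn : n₀ ≤ n) (hg : g n ≤ k) : n ≤ cut g n₀ k L :=
  Nat.le_findGreatest hL ⟨hn, hg⟩

theorem cut_spec {k L : ℕ} (h : cut g n₀ k L ≠ 0) :
    n₀ ≤ cut g n₀ k L ∧ g (cut g n₀ k L) ≤ k :=
  Nat.findGreatest_of_ne_zero (P := fun n => n₀ ≤ n ∧ g n ≤ k) rfl h

theorem cut_eq_cut {k L L' : ℕ} (hL : L ≤ L') (h : cut g n₀ k L' ≤ L) :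
    cut g n₀ k L = cut g n₀ k L' := by
  refine le_antisymm (Nat.findGreatest_mono_right _ hL) ?_
  by_cases h0 : cut g n₀ k L' = 0
  · rw [h0]
    exact Nat.zero_le _
  · exact le_cut h (cut_spec h0).1 (cut_spec h0).2

theorem cut_mono {j k : ℕ} (h : j ≤ k) (L : ℕ) : cut g n₀ j L ≤ cut g n₀ k L :=
  Nat.findGreatest_mono_left (fun _ hn => ⟨hn.1, hn.2.trans h⟩) L

theorem length_node (σ : BStr) (m : ℕ) : (node g n₀ σ m).length = m := by simp [node]

theorem take_node (σ : BStr) (m i : ℕ) : (node g n₀ σ m).take i = node g n₀ σ (min i m) := by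
  simp [node, ← List.map_take, List.take_range]

theorem node_take_cut (σ : BStr) (i : ℕ) :
    node g n₀ (σ.take (cut g n₀ (i + 2) σ.length)) (i + 1) = node g n₀ σ (i + 1) := by
  refine List.map_congr_left fun j hj => ?_
  have hle := cut_le (g := g) (n₀ := n₀) (i + 2) σ.length
  have hji : j + 2 ≤ i + 2 := by
    have := List.mem_range.1 hj
    omega
  have hmono := cut_mono (g := g) (n₀ := n₀) hji σ.length
  rw [List.length_take, min_eq_left hle, cut_eq_cut hle hmono, List.take_take, min_eq_left hmono]

theorem take_mem_nodes {D : Set BStr} {v : List BStr} (h : v ∈ nodes g n₀ D) (i : ℕ) :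
    v.take i ∈ nodes g n₀ D := by
  obtain ⟨σ, m, rfl, hσ⟩ := h
  exact ⟨σ, _, (take_node σ m i).symm, hσ⟩

theorem tsum_inv_two_pow_add (k : ℕ) : ∑' i : ℕ, (2⁻¹ : ℝ≥0∞) ^ (k + i) = 2 * 2⁻¹ ^ k := by
  simp only [pow_add, ENNReal.tsum_mul_left, ENNReal.tsum_geometric,
    ENNReal.one_sub_inv_two, inv_inv]
  rw [mul_comm]

theorem labelWeight_nodes_le (D : Set BStr) :
    LabelGame.labelWeight (nodes g n₀ D) ≤
      2⁻¹ + 2 * ∑' σ : {σ // σ ∈ D ∧ n₀ ≤ σ.length}, (2⁻¹ : ℝ≥0∞) ^ g (σ : BStr).length := by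
  let J := ℕ ⊕ ({σ // σ ∈ D ∧ n₀ ≤ σ.length} × ℕ)
  let F : J → List BStr := Sum.elim (fun i => node g n₀ [] (i + 1))
    fun x => node g n₀ x.1 (g (x.1 : BStr).length + x.2 - 1)
  let W : J → ℝ≥0∞ := Sum.elim (fun i => 2⁻¹ ^ (2 + i))
    fun x => 2⁻¹ ^ (g (x.1 : BStr).length + x.2)
  have hex (v : {v : List BStr | v ∈ nodes g n₀ D ∧ v ≠ []}) :
      ∃ j, F j = v ∧ W j = 2⁻¹ ^ ((v : List BStr).length + 1) := by
    obtain ⟨_, ⟨σ, m, rfl, hσ⟩, hne⟩ := v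
    obtain _ | i := m
    · exact absurd rfl hne
    by_cases h0 : cut g n₀ (i + 2) σ.length = 0
    · refine ⟨Sum.inl i, ?_, ?_⟩
      · change node g n₀ [] (i + 1) = node g n₀ σ (i + 1)
        rw [← node_take_cut σ, h0, List.take_zero]
      · simp only [W, Sum.elim_inl, length_node]
        congr 1
        omega
    · obtain ⟨h1, h2⟩ := cut_spec h0
      have hle := cut_le (g := g) (n₀ := n₀) (i + 2) σ.length
      have hlen : (σ.take (cut g n₀ (i + 2) σ.length)).length = cut g n₀ (i + 2) σ.length := by
        rw [List.length_take, min_eq_left hle]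
      refine ⟨Sum.inr (⟨σ.take (cut g n₀ (i + 2) σ.length), hσ _ hle h1, by rwa [hlen]⟩,
        i + 2 - g (cut g n₀ (i + 2) σ.length)), ?_, ?_⟩
      · simp only [F, Sum.elim_inr, hlen]
        rw [← node_take_cut σ]
        congr 1
        omega
      · simp only [W, Sum.elim_inr, length_node, hlen]
        congr 1
        omega
  choose j hj hW using hex
  have hinj : Function.Injective j := fun v w h => Subtype.ext (by rw [← hj v, ← hj w, h])
  calc LabelGame.labelWeight (nodes g n₀ D) = ∑' v, W (j v) := by
        simp only [LabelGame.labelWeight, hW]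
    _ ≤ ∑' x, W x := ENNReal.tsum_comp_le_tsum_of_injective hinj W
    _ = _ := by
        rw [Summable.tsum_sum ENNReal.summable ENNReal.summable]
        congr 1
        · simp only [W, Sum.elim_inl]
          rw [tsum_inv_two_pow_add, pow_two, ← mul_assoc, ENNReal.mul_inv_cancel, one_mul] <;> simp
        · simp only [W, Sum.elim_inr]
          rw [ENNReal.tsum_prod (f := fun (σ : {σ // σ ∈ D ∧ n₀ ≤ σ.length}) i =>
            (2⁻¹ : ℝ≥0∞) ^ (g (σ : BStr).length + i))]
          simp only [tsum_inv_two_pow_add, ENNReal.tsum_mul_left]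

theorem computable_cut (hg : Computable g) : Computable₂ (cut g n₀) := by
  have hc : Computable fun x : (ℕ × ℕ) × ℕ × ℕ =>
      decide (n₀ ≤ x.2.1 + 1) && decide (g (x.2.1 + 1) ≤ x.1.1) := by
    refine Primrec.and.to_comp.comp ?_ ?_
    · exact (Primrec.nat_le.decide.comp (Primrec.const n₀) (Primrec.succ.comp
        (Primrec.fst.comp Primrec.snd))).to_comp
    · exact Primrec.nat_le.decide.to_comp.comp
        (hg.comp (Computable.succ.comp (Computable.fst.comp Computable.snd)))
        (Computable.fst.comp Computable.fst)
  have h : Computable₂ fun (x : ℕ × ℕ) (y : ℕ × ℕ) =>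
      bif decide (n₀ ≤ y.1 + 1) && decide (g (y.1 + 1) ≤ x.1) then y.1 + 1 else y.2 :=
    Computable.cond hc (Computable.succ.comp (Computable.fst.comp Computable.snd))
      (Computable.snd.comp Computable.snd)
  refine (Computable.nat_rec Computable.snd (Computable.const 0) h).of_eq fun x => ?_
  obtain ⟨k, L⟩ := x
  induction L with
  | zero => rfl
  | succ L ih =>
    simp only [cut, Nat.findGreatest_succ] at ih ⊢
    rw [ih, ← Bool.decide_and, Bool.cond_decide]

theorem computable_node (hg : Computable g) : Computable₂ (node g n₀) := by
  refine Computable.map_range (f := fun (σ : BStr) i => σ.take (cut g n₀ (i + 2) σ.length)) ?_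
  refine Primrec.list_take.to_comp.comp ((computable_cut hg).comp ?_ ?_) Computable.fst
  · exact (Primrec.nat_add.comp Primrec.snd (Primrec.const 2)).to_comp
  · exact Computable.list_length.comp Computable.fst

/-- The prefixes of `σ` of length at least `n₀` are in the list `l`. -/
abbrev PrefixesMem (n₀ : ℕ) (l : List (Option BStr)) (σ : BStr) : Prop :=
  ∀ n ∈ List.range (σ.length + 1), n₀ ≤ n → ∃ o ∈ l, o = some (σ.take n)

theorem primrec_prefixesMem : PrimrecRel (PrefixesMem n₀) := by
  have h1 : PrimrecRel fun (o : Option BStr) (x : ℕ × BStr) => o = some (x.2.take x.1) :=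
    Primrec.eq.comp Primrec.fst (Primrec.option_some.comp (Primrec.list_take.comp
      (Primrec.fst.comp Primrec.snd) (Primrec.snd.comp Primrec.snd)))
  have h2 : PrimrecRel fun (n : ℕ) (x : List (Option BStr) × BStr) =>
      ¬ n₀ ≤ n ∨ ∃ o ∈ x.1, o = some (x.2.take n) :=
    (Primrec.nat_le.comp (Primrec.const n₀) Primrec.fst).not.or
      (h1.exists_mem_list.comp (Primrec.fst.comp Primrec.snd)
        (Primrec.pair Primrec.fst (Primrec.snd.comp Primrec.snd)))
  refine (h2.forall_mem_list.comp (Primrec.list_range.comp (Primrec.succ.comp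
    (Primrec.list_length.comp Primrec.snd))) Primrec.id).of_eq fun x => ?_
  simp only [PrefixesMem, imp_iff_not_or, id]

/-- An enumeration of `nodes g n₀ D` in which every element occurs infinitely often, where `r`
enumerates `D`. -/
def nodeEnum (g : ℕ → ℕ) (n₀ : ℕ) (r : ℕ → Option BStr) (s : ℕ) : Option (List BStr) :=
  (Encodable.decode (α := BStr × ℕ) s.unpair.2).bind fun x =>
    bif decide (PrefixesMem n₀ ((List.range s.unpair.1).map r) x.1) then some (node g n₀ x.1 x.2)
    else none

theorem computable_nodeEnum (hg : Computable g) {r : ℕ → Option BStr} (hr : Computable r) :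
    Computable (nodeEnum g n₀ r) := by
  have hl : Computable fun s : ℕ => (List.range s).map r :=
    (Computable.map_range (f := fun (_ : Unit) => r) (hr.comp Computable.snd)).comp
      (Computable.const ()) Computable.id
  refine Computable.option_bind (Computable.decode.comp (Computable.snd.comp Computable.unpair))
    (Computable.cond ?_ ?_ (Computable.const none))
  · exact primrec_prefixesMem.decide.to_comp.comp
      (hl.comp (Computable.fst.comp (Computable.unpair.comp Computable.fst)))
      (Computable.fst.comp Computable.snd)
  · exact Computable.option_some.comp ((computable_node hg).comp
      (Computable.fst.comp Computable.snd) (Computable.snd.comp Computable.snd))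

theorem mem_nodes_of_nodeEnum {D : Set BStr} {r : ℕ → Option BStr}
    (hr : ∀ s σ, r s = some σ → σ ∈ D) {s : ℕ} {v : List BStr} (h : nodeEnum g n₀ r s = some v) :
    v ∈ nodes g n₀ D := by
  obtain ⟨x, -, h⟩ := Option.bind_eq_some_iff.1 h
  by_cases hx : PrefixesMem n₀ ((List.range s.unpair.1).map r) x.1
  · simp only [decide_eq_true hx, cond_true, Option.some_inj] at h
    refine ⟨_, _, h, fun n hn hn₀ => ?_⟩
    obtain ⟨o, ho, rfl⟩ := hx n (List.mem_range.2 (by omega)) hn₀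
    obtain ⟨t, -, ht⟩ := List.mem_map.1 ho
    exact hr t _ ht
  · simp [decide_eq_false hx] at h

theorem exists_nodeEnum_eq {r : ℕ → Option BStr} {σ : BStr}
    (h : ∀ n ≤ σ.length, ∃ s, r s = some (σ.take n)) (m s₀ : ℕ) :
    ∃ s ≥ s₀, nodeEnum g n₀ r s = some (node g n₀ σ m) := by
  choose! f hf using h
  obtain ⟨t, ht⟩ : ∃ t, ∀ n ≤ σ.length, f n < t := by
    refine ⟨(Finset.range (σ.length + 1)).sup f + 1, fun n hn => Nat.lt_succ_of_le ?_⟩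
    exact Finset.le_sup (Finset.mem_range.2 (Nat.lt_succ_of_le hn))
  refine ⟨Nat.pair (max t s₀) (Encodable.encode (σ, m)),
    (le_max_right t s₀).trans (Nat.left_le_pair _ _), ?_⟩
  have hmem : PrefixesMem n₀ ((List.range (max t s₀)).map r) σ := fun n hn _ => by
    have hn : n ≤ σ.length := Nat.le_of_lt_succ (List.mem_range.1 hn)
    refine ⟨_, List.mem_map.2 ⟨f n, List.mem_range.2 ?_, rfl⟩, hf n hn⟩
    exact (ht n hn).trans_le (le_max_left _ _)
  simp only [nodeEnum, Nat.unpair_pair, Encodable.encodek, Option.bind_some,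
    decide_eq_true hmem, cond_true]

end Coding

section Main

variable {U : BStr →. BStr} {g : ℕ → ℕ}

theorem UniversalPFM.exists_tsum_le (hU : UniversalPFM U) (g : ℕ → ℕ) {ε : ℝ≥0∞} (hε : 0 < ε) :
    ∃ N, ∀ n₀ ≥ N, ∑' σ : {σ // σ ∈ {σ : BStr | Kof U σ ≤ g σ.length} ∧ n₀ ≤ σ.length},
      (2⁻¹ : ℝ≥0∞) ^ g (σ : BStr).length ≤ ε := by
  have h := ENNReal.tendsto_tsum_compl_atTop_zero
    (ne_top_of_le_ne_top ENNReal.one_ne_top hU.tsum_Kof_le_one)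
  obtain ⟨s, hs⟩ := (h.eventually (gt_mem_nhds hε)).exists
  refine ⟨s.sup List.length + 1, fun n₀ hn₀ => le_trans ?_ hs.le⟩
  let f : {σ // σ ∈ {σ : BStr | Kof U σ ≤ g σ.length} ∧ n₀ ≤ σ.length} → {σ // σ ∉ s} :=
    fun σ => ⟨σ, fun hσ => by
      have := Finset.le_sup (f := List.length) hσ
      have := σ.2.2
      omega⟩
  have hf : Function.Injective f := fun σ τ h => 
    Subtype.ext (congrArg (Subtype.val : {σ // σ ∉ s} → BStr) h)
  refine le_trans (ENNReal.tsum_le_tsum fun σ => ?_)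
    (ENNReal.tsum_comp_le_tsum_of_injective hf fun σ => (2⁻¹ : ℝ≥0∞) ^ Kof U σ)
  exact pow_le_pow_right_of_le_one' (by simp) σ.2.1

theorem sInf_tail_spec (g : ℕ → ℕ) (n : ℕ) :
    ∃ i, n ≤ i ∧ g i = sInf {m : ℕ | ∃ i, n ≤ i ∧ g i = m} :=
  Nat.sInf_mem (s := {m : ℕ | ∃ i, n ≤ i ∧ g i = m}) ⟨g n, n, le_rfl, rfl⟩

theorem node_stake_eq {n₀ : ℕ} (X : ℕ → Bool) {B : ℕ → ℕ} (hB : ∀ k n, g n ≤ k → n ≤ B k)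
    {L m : ℕ} (hL : ∀ i < m, B (i + 2) ≤ L) :
    node g n₀ (stake X L) m =
      (List.range m).map fun i => stake X (cut g n₀ (i + 2) (B (i + 2))) := by
  refine List.map_congr_left fun i hi => ?_
  have hcut : cut g n₀ (i + 2) L ≤ B (i + 2) := by
    by_cases h0 : cut g n₀ (i + 2) L = 0
    · rw [h0]
      exact Nat.zero_le _
    · exact hB _ _ (cut_spec h0).2
  rw [stake_length, take_stake _ (cut_le _ _),
    cut_eq_cut (hL i (List.mem_range.1 hi)) hcut]

/-- The decoder: the last term of the label of `y` is a prefix of `X` of length at least `n`. -/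
theorem computableWithUse_of_label {e : ℕ → Option (List BStr) × Option BStr} (he : Computable e)
    {X Y : ℕ → Bool} {p : ℕ → BStr} {f : ℕ → ℕ} (n₀ : ℕ)
    (hf : ∀ n ≥ n₀, 2 ≤ f n)
    (hY : ∀ m, (List.range m).map p ∈ LabelGame.label e (stake Y (m + 1)))
    (hp : ∀ n ≥ n₀, (p (f n - 2)).take n = stake X n) : ComputableWithUse X Y f := by
  refine ⟨fun x => bif decide (x.1 < n₀) then Part.some ((stake X n₀).take x.1)
    else (LabelGame.label e x.2).map fun v => ((v[x.2.length - 2]?).getD []).take x.1, ?_, ?_⟩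
  · refine Partrec.cond ?_ (Computable.partrec ?_)
      (((LabelGame.partrec_label he).comp Computable.snd).map (Primrec.to_comp ?_))
    · exact (Primrec.nat_lt.decide.comp Primrec.fst (Primrec.const n₀)).to_comp
    · exact (Primrec.list_take.comp Primrec.fst (Primrec.const _)).to_comp
    · refine Primrec.list_take.comp (Primrec.fst.comp Primrec.fst) (Primrec.option_getD.comp
        (Primrec.list_getElem?.comp Primrec.snd ?_) (Primrec.const []))
      exact Primrec.nat_sub.comp (Primrec.list_length.comp (Primrec.snd.comp Primrec.fst))
        (Primrec.const 2)
  · intro n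
    by_cases hn : n < n₀
    · simp [hn, take_stake _ hn.le]
    · simp only [hn, decide_false, cond_false]
      push Not at hn
      obtain ⟨m, hm⟩ := Nat.exists_eq_add_of_le' (hf n hn)
      have := hp n hn
      rw [hm] at this ⊢
      refine (Part.mem_map_iff _).2 ⟨_, hY (m + 1), ?_⟩
      simpa [stake_length] using this

end Main

/-- Theorem: if `g` is a computable upper bound on the prefix-free initial segment
complexity of `X`, then `X` is computable from a Martin-Löf random `Y` with
oracle-use `n ↦ min_{i ≥ n} g(i)`. -/
theorem stmt2 (U : BStr →. BStr) (hU : UniversalPFM U)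
    (X : ℕ → Bool) (g : ℕ → ℕ) (hg : Computable g)
    (hbound : ∀ n, Kof U (stake X n) ≤ g n) :
    ∃ Y : ℕ → Bool, MLRandom U Y ∧
      ComputableWithUse X Y (fun n => sInf {m : ℕ | ∃ i, n ≤ i ∧ g i = m}) := by
  obtain ⟨u, hu, hspec⟩ := hU.1.1.exists_enumeration
  have hfin (k : ℕ) : ∃ b, ∀ n, g n ≤ k → n ≤ b := by
    obtain ⟨b, hb⟩ := (hU.finite_Kof_stake_le X k).bddAbove
    exact ⟨b, fun n hn => hb ((hbound n).trans hn)⟩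
  choose B hB using hfin
  obtain ⟨N, hN⟩ := hU.exists_tsum_le g (ε := 2⁻¹ ^ 3) (ENNReal.pow_pos (by simp) 3)
  set n₀ := max N (B 1 + 1) with hn₀
  set D : Set BStr := {σ | Kof U σ ≤ g σ.length}
  let r : ℕ → Option BStr := fun s => (u s).bind fun p =>
    bif decide (p.1.length ≤ g p.2.length) then some p.2 else none
  have hr : Computable r := Computable.filter_snd hu (Primrec.nat_le.decide.to_comp.comp
    (Computable.list_length.comp Computable.fst)
    (hg.comp (Computable.list_length.comp Computable.snd)))
  have hrD : ∀ s σ, r s = some σ → σ ∈ D := by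
    intro s σ h
    obtain ⟨⟨ρ, τ⟩, hs, h⟩ := Option.bind_eq_some_iff.1 h
    by_cases hl : ρ.length ≤ g τ.length
    · simp only [hl, decide_true, cond_true, Option.some_inj] at h
      subst h
      exact (Kof_le_length ((hspec _ _).2 ⟨s, hs⟩)).trans hl
    · simp [hl] at h
  have hrX (n : ℕ) : ∃ s, r s = some (stake X n) := by
    obtain ⟨ρ, hρ, hl⟩ := hU.exists_description (stake X n)
    obtain ⟨s, hs⟩ := (hspec _ _).1 hρ
    have := hbound n
    refine ⟨s, ?_⟩
    simp [r, hs, hl, stake_length, this]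
  let q : ℕ → Option BStr := fun s => (u s).bind fun p =>
    bif decide (p.1.length + 2 < p.2.length) then some p.2 else none
  have hq : Computable q := Computable.filter_snd hu
    (Primrec.nat_lt.decide.comp (Primrec.nat_add.comp (Primrec.list_length.comp Primrec.fst)
      (Primrec.const 2)) (Primrec.list_length.comp Primrec.snd)).to_comp
  have hqQ : ∀ s σ, q s = some σ → σ ∈ {σ : BStr | Kof U σ + 2 < σ.length} := by
    intro s σ h
    obtain ⟨⟨ρ, τ⟩, hs, h⟩ := Option.bind_eq_some_iff.1 h
    by_cases hl : ρ.length + 2 < τ.length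
    · simp only [hl, decide_true, cond_true, Option.some_inj] at h
      subst h
      have := Kof_le_length ((hspec _ _).2 ⟨s, hs⟩)
      exact lt_of_le_of_lt (Nat.add_le_add_right this 2) hl
    · simp [hl] at h
  have hW : LabelGame.labelWeight (nodes g n₀ D) + strWeight {σ | Kof U σ + 2 < σ.length} < 1 := by
    calc _ ≤ (2⁻¹ + 2 * 2⁻¹ ^ 3) + (2⁻¹ : ℝ≥0∞) ^ 3 := by
          refine add_le_add ((labelWeight_nodes_le D).trans ?_) hU.strWeight_compressible_le
          gcongr
          exact hN n₀ (le_max_left _ _)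
      _ < 1 := by
          rw [← ENNReal.toReal_lt_toReal (by finiteness) (by simp)]
          rw [ENNReal.toReal_add (by finiteness) (by finiteness),
            ENNReal.toReal_add (by finiteness) (by finiteness)]
          norm_num
  let p : ℕ → BStr := fun i => stake X (cut g n₀ (i + 2) (B (i + 2)))
  let e : ℕ → Option (List BStr) × Option BStr := fun s => (nodeEnum g n₀ r s, q s)
  have he : Computable e := (computable_nodeEnum hg hr).pair hq
  have heT : ∀ s w, (e s).1 = some w → ∀ i, w.take i ∈ nodes g n₀ D :=
    fun s w h i => take_mem_nodes (mem_nodes_of_nodeEnum hrD h) i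
  have hp (m s₀ : ℕ) : ∃ s ≥ s₀, (e s).1 = some ((List.range m).map p) := by
    rw [← node_stake_eq X hB (L := (Finset.range m).sup fun i => B (i + 2)) fun i hi =>
      Finset.le_sup (f := fun i => B (i + 2)) (Finset.mem_range.2 hi)]
    refine exists_nodeEnum_eq (fun n hn => ?_) m s₀
    rw [take_stake _ (by rwa [stake_length] at hn)]
    exact hrX n
  obtain ⟨Y, hY, hYQ⟩ := LabelGame.exists_stream heT hqQ hW p hp
  have hinf (n : ℕ) (hn : n ≥ n₀) : 2 ≤ sInf {m : ℕ | ∃ i, n ≤ i ∧ g i = m} := by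
    obtain ⟨i, hi, h⟩ := sInf_tail_spec g n
    rw [← h]
    by_contra! hlt
    have := hB 1 i (by omega)
    omega
  refine ⟨Y, ⟨2, fun n => ?_⟩, computableWithUse_of_label (p := p) he n₀ hinf (fun m => ?_) ?_⟩
  · by_contra! hlt
    obtain ⟨ρ, hρ, hl⟩ := hU.exists_description (stake Y n)
    obtain ⟨s, hs⟩ := (hspec _ _).1 hρ
    refine hYQ s _ n ?_ rfl
    simp [e, q, hs, hl, stake_length, hlt]
  · obtain ⟨s, hs⟩ := hY m
    exact LabelGame.mem_label heT hs
  · intro n hn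
    obtain ⟨i, hi, h⟩ := sInf_tail_spec g n
    have h2 := hinf n hn
    refine take_stake _ (hi.trans (le_cut (hB _ _ ?_) (hn.trans hi) ?_)) <;> omega
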